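/- arXiv:2405.14364 — 2 statements merged into one kernel-verified Lean document; each statement's English description precedes it below -/
import Mathlib

section
/- Let (φ, ξ, η, g) be an accR structure on a real vector space V of dimension 2n+1 with g nondegenerate, and let g̃(x, y) = g(x, φ(y)) + η(x)η(y) be the associated metric. Suppose a bilinear form ρ satisfies ρ = a·g + b·g̃ + c·(η⊗η) for real numbers a, b, c, and let A* be the unique endomorphism of V with g(A*(x), y) = ρ(x, φ(y)) for all x, y. Then the trace of A* equals -2nb. -/
/-- A real matrix whose cube is its negative has trace zero. -/
theorem Matrix.trace_eq_zero_of_mul_mul_self_eq_neg {ι : Type*} [Fintype ι] [DecidableEq ι]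
    (M : Matrix ι ι ℝ) (h : M * M * M = -M) : M.trace = 0 := by
  set N : Matrix ι ι ℂ := M.map Complex.ofRealHom with hN
  have hNNN : N * N * N = -N := by
    rw [hN, ← Matrix.map_mul, ← Matrix.map_mul, h]
    ext i j
    simp
  have hNNNN : N * N * (N * N) = -(N * N) := by rw [← mul_assoc, hNNN, neg_mul]
  have hP : IsIdempotentElem ((-1 / 2 : ℂ) • (N * N + Complex.I • N)) := by
    have hsq : (N * N + Complex.I • N) * (N * N + Complex.I • N)
        = (-2 : ℂ) • (N * N + Complex.I • N) := by
      simp only [add_mul, mul_add, smul_mul_assoc, mul_smul_comm, hNNNN, hNNN, ← mul_assoc N N N,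
        smul_add, smul_smul, Complex.I_mul_I]
      module
    rw [IsIdempotentElem, smul_mul_smul_comm, hsq, smul_smul]
    norm_num
  have htr := (LinearMap.IsIdempotentElem.isProj_range _
    (hP.map (Matrix.toLinAlgEquiv' (R := ℂ)))).trace
  have htrN : N.trace = (M.trace : ℂ) := by
    simp [hN, Matrix.trace]
  have htrNN : (N * N).trace = ((M * M).trace : ℂ) := by
    simp [hN, ← Matrix.map_mul, Matrix.trace, Matrix.mul_apply]
  erw [Matrix.trace_toLin'_eq] at htr
  rw [Matrix.trace_smul, Matrix.trace_add, Matrix.trace_smul, htrN, htrNN] at htr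
  simpa using congrArg Complex.im htr

/-- A real endomorphism whose cube is its negative has trace zero. -/
theorem LinearMap.trace_eq_zero_of_apply_apply_apply_eq_neg {V : Type*} [AddCommGroup V]
    [Module ℝ V] [FiniteDimensional ℝ V] (f : V →ₗ[ℝ] V) (h : ∀ x, f (f (f x)) = -f x) :
    LinearMap.trace ℝ V f = 0 := by
  let B := Module.finBasis ℝ V
  rw [LinearMap.trace_eq_matrix_trace ℝ B]
  apply Matrix.trace_eq_zero_of_mul_mul_self_eq_neg
  rw [← LinearMap.toMatrix_mul, ← LinearMap.toMatrix_mul, ← map_neg]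
  congr 1
  ext x
  simpa using h x

/-- On a (2n+1)-dimensional accR vector space with nondegenerate g,
if ρ = a·g + b·g̃ + c·(η⊗η) and A* is the endomorphism with g(A* x, y) = ρ(x, φy),
then trace A* = -2nb. -/
theorem accR_einstein_like_star_trace
    (n : ℕ) (hn : 0 < n)
    (V : Type*) [AddCommGroup V] [Module ℝ V] [FiniteDimensional ℝ V]
    (hdim : Module.finrank ℝ V = 2 * n + 1)
    (φ : V →ₗ[ℝ] V) (ξ : V) (η : V →ₗ[ℝ] ℝ) (g : LinearMap.BilinForm ℝ V)
    (hgsymm : ∀ x y : V, g x y = g y x)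
    (hφξ : φ ξ = 0)
    (hφφ : ∀ x : V, φ (φ x) = -x + η x • ξ)
    (hηφ : ∀ x : V, η (φ x) = 0)
    (hηξ : η ξ = 1)
    (hg : ∀ x y : V, g (φ x) (φ y) = -g x y + η x * η y)
    (hnd : ∀ x : V, (∀ y : V, g x y = 0) → x = 0)
    (ρ : LinearMap.BilinForm ℝ V) (a b c : ℝ)
    (hρ : ∀ x y : V, ρ x y = a * g x y + b * (g x (φ y) + η x * η y) + c * (η x * η y))
    (Astar : V →ₗ[ℝ] V)
    (hAstar : ∀ x y : V, g (Astar x) y = ρ x (φ y)) :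
    LinearMap.trace ℝ V Astar = -(2 * (n : ℝ)) * b := by
  have hgξ (x : V) : g x ξ = η x := by
    have := hg x ξ
    rw [hφξ, map_zero, hηξ] at this
    linarith
  have hgφ (x y : V) : g x (φ y) = g (φ x) y := by
    have := hg x (φ y)
    rw [hφφ, hηφ, map_add, map_neg, map_smul, hgξ, hηφ, smul_zero] at this
    linarith
  have hA : Astar = a • φ + b • (η.smulRight ξ - LinearMap.id) := by
    ext x
    refine sub_eq_zero.mp (hnd _ fun y ↦ ?_)
    have hξy : g ξ y = η y := by rw [hgsymm, hgξ]
    simp [hAstar, hρ, hφφ, hηφ, hgφ, hgξ, hξy]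
    ring
  have hφtr : LinearMap.trace ℝ V φ = 0 :=
    LinearMap.trace_eq_zero_of_apply_apply_apply_eq_neg φ fun x ↦ by simp [hφφ, hφξ]
  rw [hA, map_add, map_smul, map_smul, map_sub, hφtr, LinearMap.trace_smulRight, hηξ,
    LinearMap.trace_id, hdim]
  push_cast
  simp only [smul_eq_mul]
  ring
end

section
/- On ℝ⁵ with standard basis e₀, e₁, e₂, e₃, e₄, fix real numbers p and q and let [·,·] be the Lie bracket defined by [e₀,e₁] = p·e₂ + e₃ + q·e₄, [e₀,e₂] = -p·e₁ - q·e₃ + e₄, [e₀,e₃] = -e₁ - q·e₂ + p·e₄, [e₀,e₄] = q·e₁ - e₂ - p·e₃, and [eᵢ,eⱼ] = 0 for i, j ∈ {1,2,3,4}. Let g be the nondegenerate symmetric bilinear form with g(e₀,e₀) = g(e₁,e₁) = g(e₂,e₂) = 1, g(e₃,e₃) = g(e₄,e₄) = -1 and g(eᵢ,eⱼ) = 0 for i ≠ j, and let η be the linear functional η(x) = g(x, e₀). Define the bilinear map ∇ : ℝ⁵ × ℝ⁵ → ℝ⁵ by the Koszul formula 2g(∇ₓy, z) = g([x,y], z)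 - g([y,z], x) + g([z,x], y) for all z, and the curvature R(x,y)z = ∇ₓ(∇_y z) - ∇_y(∇ₓ z) - ∇_{[x,y]} z. Then the Ricci tensor ρ(x, y) := trace of the linear map z ↦ R(z, x)y satisfies ρ(x, y) = 4·η(x)·η(y) for all x, y ∈ ℝ⁵. -/
/-- The standard basis vectors of ℝ⁵. -/
def stdBasis5 (i : Fin 5) : Fin 5 → ℝ := Pi.single i 1

/-- The left-invariant pseudo-Riemannian B-metric of signature (3,2) on ℝ⁵:
g(e₀,e₀) = g(e₁,e₁) = g(e₂,e₂) = 1, g(e₃,e₃) = g(e₄,e₄) = -1, g(eᵢ,eⱼ) = 0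
for i ≠ j. -/
def gB (x y : Fin 5 → ℝ) : ℝ :=
  x 0 * y 0 + x 1 * y 1 + x 2 * y 2 - x 3 * y 3 - x 4 * y 4

/-- Expansion of a vector of ℝ⁵ in the standard basis. -/
theorem eq_sum_stdBasis5 (x : Fin 5 → ℝ) :
    x = x 0 • stdBasis5 0 + x 1 • stdBasis5 1 + x 2 • stdBasis5 2
      + x 3 • stdBasis5 3 + x 4 • stdBasis5 4 := by
  ext i
  fin_cases i <;> simp [stdBasis5]

/-- A linear endomorphism of ℝ⁵ has trace the sum of its diagonal entries. -/
theorem trace_eq_sum_stdBasis5 (f : (Fin 5 → ℝ) →ₗ[ℝ] (Fin 5 → ℝ)) :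
    LinearMap.trace ℝ (Fin 5 → ℝ) f = ∑ i, f (stdBasis5 i) i := by
  rw [LinearMap.trace_eq_matrix_trace ℝ (Pi.basisFun ℝ (Fin 5)), Matrix.trace]
  simp [stdBasis5]

/-- For the 5-dimensional Lie algebra with the stated bracket, the
metric gB, η(x) = gB(x, e₀), the Levi-Civita connection ∇ given by the Koszul
formula, and R(x,y)z = ∇ₓ∇_y z - ∇_y ∇ₓ z - ∇_{[x,y]} z, the Ricci tensor
ρ(x,y) = tr(z ↦ R(z,x)y) equals 4 η(x) η(y). -/
theorem example_ricci_tensor (p q : ℝ)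
    (B : (Fin 5 → ℝ) →ₗ[ℝ] (Fin 5 → ℝ) →ₗ[ℝ] (Fin 5 → ℝ))
    (hanti : ∀ x y : Fin 5 → ℝ, B x y = -B y x)
    (h01 : B (stdBasis5 0) (stdBasis5 1)
      = p • stdBasis5 2 + stdBasis5 3 + q • stdBasis5 4)
    (h02 : B (stdBasis5 0) (stdBasis5 2)
      = -(p • stdBasis5 1) - q • stdBasis5 3 + stdBasis5 4)
    (h03 : B (stdBasis5 0) (stdBasis5 3)
      = -stdBasis5 1 - q • stdBasis5 2 + p • stdBasis5 4)
    (h04 : B (stdBasis5 0) (stdBasis5 4)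
      = q • stdBasis5 1 - stdBasis5 2 - p • stdBasis5 3)
    (h0 : ∀ i j : Fin 5, i ≠ 0 → j ≠ 0 → B (stdBasis5 i) (stdBasis5 j) = 0)
    (nabla : (Fin 5 → ℝ) →ₗ[ℝ] (Fin 5 → ℝ) →ₗ[ℝ] (Fin 5 → ℝ))
    (hKoszul : ∀ x y z : Fin 5 → ℝ,
      2 * gB (nabla x y) z = gB (B x y) z - gB (B y z) x + gB (B z x) y) :
    ∀ x y : Fin 5 → ℝ,
      LinearMap.trace ℝ (Fin 5 → ℝ)
        (nabla.flip (nabla x y) - nabla x ∘ₗ nabla.flip y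
          - nabla.flip y ∘ₗ B.flip x)
      = 4 * gB x (stdBasis5 0) * gB y (stdBasis5 0) := by
  have hB : ∀ x y : Fin 5 → ℝ, B x y =
      ![0,
        -p * (x 0 * y 2 - x 2 * y 0) - (x 0 * y 3 - x 3 * y 0) + q * (x 0 * y 4 - x 4 * y 0),
        p * (x 0 * y 1 - x 1 * y 0) - q * (x 0 * y 3 - x 3 * y 0) - (x 0 * y 4 - x 4 * y 0),
        (x 0 * y 1 - x 1 * y 0) - q * (x 0 * y 2 - x 2 * y 0) - p * (x 0 * y 4 - x 4 * y 0),
        q * (x 0 * y 1 - x 1 * y 0) + (x 0 * y 2 - x 2 * y 0) + p * (x 0 * y 3 - x 3 * y 0)] := by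
    intro x y
    have h00 : B (stdBasis5 0) (stdBasis5 0) = 0 := self_eq_neg.mp (hanti _ _)
    have h10 := hanti (stdBasis5 1) (stdBasis5 0)
    have h20 := hanti (stdBasis5 2) (stdBasis5 0)
    have h30 := hanti (stdBasis5 3) (stdBasis5 0)
    have h40 := hanti (stdBasis5 4) (stdBasis5 0)
    rw [h01] at h10
    rw [h02] at h20
    rw [h03] at h30
    rw [h04] at h40
    conv_lhs => rw [eq_sum_stdBasis5 x, eq_sum_stdBasis5 y]
    simp only [map_add, map_smul, LinearMap.add_apply, LinearMap.smul_apply,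
      h00, h01, h02, h03, h04, h10, h20, h30, h40,
      h0 1 1 (by decide) (by decide), h0 1 2 (by decide) (by decide),
      h0 1 3 (by decide) (by decide), h0 1 4 (by decide) (by decide),
      h0 2 1 (by decide) (by decide), h0 2 2 (by decide) (by decide),
      h0 2 3 (by decide) (by decide), h0 2 4 (by decide) (by decide),
      h0 3 1 (by decide) (by decide), h0 3 2 (by decide) (by decide),
      h0 3 3 (by decide) (by decide), h0 3 4 (by decide) (by decide),
      h0 4 1 (by decide) (by decide), h0 4 2 (by decide) (by decide),
      h0 4 3 (by decide) (by decide), h0 4 4 (by decide) (by decide)]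
    ext i
    fin_cases i <;> simp [stdBasis5] <;> ring
  have hN : ∀ x y : Fin 5 → ℝ, nabla x y =
      ![-(x 1 * y 3 + x 3 * y 1 + x 2 * y 4 + x 4 * y 2),
        -p * x 0 * y 2 + q * x 0 * y 4 + x 3 * y 0,
        p * x 0 * y 1 - q * x 0 * y 3 + x 4 * y 0,
        -q * x 0 * y 2 - p * x 0 * y 4 - x 1 * y 0,
        q * x 0 * y 1 + p * x 0 * y 3 - x 2 * y 0] := by
    intro x y
    have k0 := hKoszul x y (stdBasis5 0)
    have k1 := hKoszul x y (stdBasis5 1)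
    have k2 := hKoszul x y (stdBasis5 2)
    have k3 := hKoszul x y (stdBasis5 3)
    have k4 := hKoszul x y (stdBasis5 4)
    simp [gB, hB, stdBasis5] at k0 k1 k2 k3 k4
    ext i
    fin_cases i <;> simp <;> linarith
  intro x y
  rw [trace_eq_sum_stdBasis5]
  simp [Fin.sum_univ_five, hN, hB, gB, stdBasis5]
  ring
end
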